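/- Suppose ι satisfies the positivity assumption: for every φ = Σ_k φ_k x_k ∈ Ξ_ι and every k with k^(−) = 0 one has φ_k ≥ 0. Let w = s_{i_L}⋯s_{i_1} be a reduced word in the Weyl group W of A whose letters i_1,…,i_L are the first L terms of ι, and let D_L(∞) be the subset of ℤ^∞_ι obtained from {0̄} by successively closing under the powers of f̃_{i_1}, …, f̃_{i_L}. Then D_L(∞) = { x ∈ ℤ^∞ : φ(x) ≥ 0 for every φ ∈ Ξ_ι, and x_k = 0 for all k > L }. -/

import Mathlib

noncomputable section

namespace PaperNakashima

variable {I : Type*} [DecidableEq I]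

/-- `σ_k(x) = x_k + Σ_{j>k} a_{i_k i_j} x_j`. -/
def sig (A : I → I → ℤ) (ι : ℕ → I) (k : ℕ) (x : ℕ →₀ ℤ) : ℤ :=
  x k + ∑ j ∈ x.support.filter (fun j => k < j), A (ι k) (ι j) * x j

/-- `σ_0^{(i)}(x) = -λ_i + Σ_{j≥1} a_{i i_j} x_j`. -/
def sig0 (A : I → I → ℤ) (ι : ℕ → I) (lam : I → ℤ) (i : I) (x : ℕ →₀ ℤ) : ℤ :=
  -lam i + ∑ j ∈ x.support.filter (fun j => 1 ≤ j), A i (ι j) * x j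

/-- `σ^{(i)}(x) = max_{k ≥ 1, i_k = i} σ_k(x)`. -/
def sigMax (A : I → I → ℤ) (ι : ℕ → I) (i : I) (x : ℕ →₀ ℤ) : ℤ :=
  sSup ((fun k => sig A ι k x) '' {k | 1 ≤ k ∧ ι k = i})

/-- `M^{(i)}(x) = {k ≥ 1 : i_k = i, σ_k(x) = σ^{(i)}(x)}`. -/
def Mset (A : I → I → ℤ) (ι : ℕ → I) (i : I) (x : ℕ →₀ ℤ) : Set ℕ :=
  {k | 1 ≤ k ∧ ι k = i ∧ sig A ι k x = sigMax A ι i x}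

/-- The Kashiwara operator `f̃_i` on `ℤ^∞_ι[λ] ⊔ {0}`, with `none` playing the role of `0`. -/
def ftil (A : I → I → ℤ) (ι : ℕ → I) (lam : I → ℤ) (i : I) :
    Option (ℕ →₀ ℤ) → Option (ℕ →₀ ℤ)
  | none => none
  | some x =>
    if sig0 A ι lam i x < sigMax A ι i x then
      some (x + Finsupp.single (sInf (Mset A ι i x)) 1)
    else none

/-- The Kashiwara operator `ẽ_i` on `ℤ^∞_ι[λ] ⊔ {0}`. -/
def etil (A : I → I → ℤ) (ι : ℕ → I) (lam : I → ℤ) (i : I) :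
    Option (ℕ →₀ ℤ) → Option (ℕ →₀ ℤ)
  | none => none
  | some x =>
    if 0 < sigMax A ι i x ∧ sig0 A ι lam i x ≤ sigMax A ι i x then
      some (x - Finsupp.single (sSup (Mset A ι i x)) 1)
    else none

/-- `ε_i(x) = max(σ^{(i)}(x), σ_0^{(i)}(x))`. -/
def eps (A : I → I → ℤ) (ι : ℕ → I) (lam : I → ℤ) (i : I) (x : ℕ →₀ ℤ) : ℤ :=
  max (sigMax A ι i x) (sig0 A ι lam i x)

/-- `φ_i(x) = ε_i(x) - σ_0^{(i)}(x) = ⟨h_i, wt(x)⟩ + ε_i(x)`. -/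
def phi (A : I → I → ℤ) (ι : ℕ → I) (lam : I → ℤ) (i : I) (x : ℕ →₀ ℤ) : ℤ :=
  eps A ι lam i x - sig0 A ι lam i x

/-- `F(λ)`: the image of `B(λ)` under the Kashiwara embedding, i.e. all nonzero elements
obtained from the highest weight element `0̄` by applying Kashiwara operators `f̃`. -/
def FSet (A : I → I → ℤ) (ι : ℕ → I) (lam : I → ℤ) : Set (ℕ →₀ ℤ) :=
  {x | ∃ l : List I, List.foldl (fun y i => ftil A ι lam i y) (some 0) l = some x}

/-- The Demazure subsets `D_k`: `D_0 = {0̄}` and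
`D_k = { f̃_{i_k}^m(x) : m ≥ 0, x ∈ D_{k-1} } \ {0}`. -/
def Dem (A : I → I → ℤ) (ι : ℕ → I) (lam : I → ℤ) : ℕ → Set (ℕ →₀ ℤ)
  | 0 => {0}
  | (k+1) => {y | ∃ m : ℕ, ∃ x ∈ Dem A ι lam k,
      (ftil A ι lam (ι (k+1)))^[m] (some x) = some y}

/-- The Coxeter matrix entry attached to a generalized Cartan matrix:
`m_{ij} = 2, 3, 4, 6, ∞(=0)` according as `a_{ij} a_{ji} = 0, 1, 2, 3, ≥ 4`. -/
def coxEntry (A : I → I → ℤ) (i j : I) : ℕ :=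
  if i = j then 1
  else if A i j * A j i = 0 then 2
  else if A i j * A j i = 1 then 3
  else if A i j * A j i = 2 then 4
  else if A i j * A j i = 3 then 6
  else 0

/-- The Coxeter matrix of the Weyl group of a generalized Cartan matrix `A`. -/
def coxOf (A : I → I → ℤ) : CoxeterMatrix I where
  M := Matrix.of fun i j => coxEntry A i j
  isSymm := by
    ext i j
    by_cases h : i = j
    · simp [coxEntry, h]
    · simp only [Matrix.transpose_apply, Matrix.of_apply, coxEntry, if_neg h,
        if_neg (Ne.symm h), mul_comm (A i j) (A j i)]
  diagonal i := by simp [coxEntry]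
  off_diagonal i j h := by
    simp only [Matrix.of_apply, coxEntry, if_neg h]
    split_ifs <;> decide

/-- The word `i_L, i_{L-1}, …, i_1` (the first `L` letters of `ι`, read backwards). -/
def demWord (ι : ℕ → I) (L : ℕ) : List I :=
  (List.range L).map (fun k => ι (L - k))

/-- The Kashiwara operator `f̃_i` on `ℤ^∞_ι` (the `B(∞)` version, which is never `0`):
add `1` to the entry at position `min M^{(i)}(x)`. -/
def ftilInf (A : I → I → ℤ) (ι : ℕ → I) (i : I) (x : ℕ →₀ ℤ) : ℕ →₀ ℤ :=
  x + Finsupp.single (sInf (Mset A ι i x)) 1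

/-- `F(∞)`: the image of `B(∞)` under the Kashiwara embedding `Ψ_ι`, i.e. all elements
obtained from `0̄` by applying the operators `f̃`. -/
def FInf (A : I → I → ℤ) (ι : ℕ → I) : Set (ℕ →₀ ℤ) :=
  {x | ∃ l : List I, List.foldl (fun y i => ftilInf A ι i y) 0 l = x}

/-- The Demazure subsets `D_k(∞)`: `D_0(∞) = {0̄}` and
`D_k(∞) = { f̃_{i_k}^m(x) : m ≥ 0, x ∈ D_{k-1}(∞) }`. -/
def DemInf (A : I → I → ℤ) (ι : ℕ → I) : ℕ → Set (ℕ →₀ ℤ)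
  | 0 => {0}
  | (k+1) => {y | ∃ m : ℕ, ∃ x ∈ DemInf A ι k, (ftilInf A ι (ι (k+1)))^[m] x = y}

/-- `k^{(-)} = max { l : 1 ≤ l < k, i_l = i_k }` (`0` if there is no such `l`). -/
def kminus (ι : ℕ → I) (k : ℕ) : ℕ :=
  sSup {l | 1 ≤ l ∧ l < k ∧ ι l = ι k}

/-- `k^{(+)} = min { l : l > k, i_l = i_k }`. -/
def kplus (ι : ℕ → I) (k : ℕ) : ℕ :=
  sInf {l | k < l ∧ ι l = ι k}

/-- The linear form `β_k(x) = x_k + Σ_{k<j<k^{(+)}} a_{i_k i_j} x_j + x_{k^{(+)}}` for `k ≥ 1`,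
with `β_0 = 0`, encoded as a finitely supported coefficient vector. -/
def betaInf (A : I → I → ℤ) (ι : ℕ → I) (k : ℕ) : ℕ →₀ ℤ :=
  if k = 0 then 0
  else Finsupp.single k 1 + Finsupp.single (kplus ι k) 1 +
    ∑ j ∈ Finset.Ioo k (kplus ι k), Finsupp.single j (A (ι k) (ι j))

/-- The operator `S_k`: `S_k(φ) = φ − φ_k β_k` if `φ_k > 0`, and
`S_k(φ) = φ − φ_k β_{k^{(-)}}` if `φ_k ≤ 0`. -/
def Sop (A : I → I → ℤ) (ι : ℕ → I) (k : ℕ) (φ : ℕ →₀ ℤ) : ℕ →₀ ℤ :=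
  if 0 < φ k then φ - φ k • betaInf A ι k
  else φ - φ k • betaInf A ι (kminus ι k)

/-- The set `Ξ_ι = { S_{j_l}⋯S_{j_1}(x_{j_0}) : l ≥ 0, j_0, …, j_l ≥ 1 }` of linear forms. -/
inductive XiInf (A : I → I → ℤ) (ι : ℕ → I) : (ℕ →₀ ℤ) → Prop
  | coord (j : ℕ) (hj : 1 ≤ j) : XiInf A ι (Finsupp.single j 1)
  | s (k : ℕ) (hk : 1 ≤ k) (φ : ℕ →₀ ℤ) (hφ : XiInf A ι φ) : XiInf A ι (Sop A ι k φ)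

/-- Evaluation of a linear form `φ(x) = Σ_k φ_k x_k` at `x`. -/
def evalLin (φ : ℕ →₀ ℤ) (x : ℕ →₀ ℤ) : ℤ :=
  ∑ j ∈ φ.support, φ j * x j

set_option linter.unusedSectionVars false

/-- The coefficient of `x_j` in the linear form `σ_k`. -/
def sigCoeff (A : I → I → ℤ) (ι : ℕ → I) (k j : ℕ) : ℤ :=
  if j = k then 1 else if k < j then A (ι k) (ι j) else 0

lemma sig_eq_sum (A : I → I → ℤ) (ι : ℕ → I) (k : ℕ) (x : ℕ →₀ ℤ) :
    sig A ι k x = x.sum fun j c => sigCoeff A ι k j * c := by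
  have hx : x k = ∑ j ∈ x.support, if j = k then x j else 0 := by
    by_cases h : x k = 0 <;> simp [h]
  rw [sig, Finset.sum_filter, hx, ← Finset.sum_add_distrib, Finsupp.sum]
  refine Finset.sum_congr rfl fun j _ => ?_
  unfold sigCoeff
  split_ifs <;> simp
  omega

lemma evalLin_eq_sum (φ x : ℕ →₀ ℤ) : evalLin φ x = x.sum fun j c => φ j * c :=
  (Finset.sum_subset Finset.subset_union_left (by simp +contextual)).trans
    (Finset.sum_subset (Finset.subset_union_right (s₁ := φ.support)) (by simp +contextual)).symm

lemma sum_coeff_add (c : ℕ → ℤ) (x y : ℕ →₀ ℤ) :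
    ((x + y).sum fun j z => c j * z) = (x.sum fun j z => c j * z) + y.sum fun j z => c j * z :=
  Finsupp.sum_add_index' (by simp) (by simp [mul_add])

lemma evalLin_add_single (φ x : ℕ →₀ ℤ) (p : ℕ) (n : ℤ) :
    evalLin φ (x + Finsupp.single p n) = evalLin φ x + φ p * n := by
  simp only [evalLin_eq_sum, sum_coeff_add]
  simp

lemma sig_add_single (A : I → I → ℤ) (ι : ℕ → I) (k : ℕ) (x : ℕ →₀ ℤ) (p : ℕ) (n : ℤ) :
    sig A ι k (x + Finsupp.single p n) = sig A ι k x + sigCoeff A ι k p * n := by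
  simp only [sig_eq_sum, sum_coeff_add]
  simp

lemma evalLin_sub_smul (φ ψ x : ℕ →₀ ℤ) (n : ℤ) :
    evalLin (φ - n • ψ) x = evalLin φ x - n * evalLin ψ x := by
  simp only [evalLin_eq_sum, Finsupp.sum, Finset.mul_sum, ← Finset.sum_sub_distrib]
  refine Finset.sum_congr rfl fun j _ => ?_
  simp only [Finsupp.coe_sub, Finsupp.coe_smul, Pi.sub_apply, Pi.smul_apply, smul_eq_mul]
  ring

/-- `σ_q - σ_{q^{(+)}} = β_q`. -/
lemma evalLin_betaInf {A : I → I → ℤ} {ι : ℕ → I} (hAdiag : ∀ i, A i i = 2) {q p : ℕ}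
    (hq : 1 ≤ q) (hqp : q < p) (hι : ι p = ι q) (hp : kplus ι q = p) (x : ℕ →₀ ℤ) :
    evalLin (betaInf A ι q) x = sig A ι q x - sig A ι p x := by
  simp only [evalLin_eq_sum, sig_eq_sum, Finsupp.sum, ← Finset.sum_sub_distrib, ← sub_mul]
  refine Finset.sum_congr rfl fun j _ => congrArg (· * x j) ?_
  have hsum : (∑ l ∈ Finset.Ioo q p, Finsupp.single l (A (ι q) (ι l))) j
      = if q < j ∧ j < p then A (ι q) (ι j) else 0 := by
    simp [Finsupp.finsetSum_apply, Finsupp.single_apply]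
  rw [betaInf, if_neg (by omega), hp, Finsupp.add_apply, Finsupp.add_apply, hsum,
    Finsupp.single_apply, Finsupp.single_apply]
  unfold sigCoeff
  rcases lt_trichotomy j q with h | rfl | h
  · simp [show q ≠ j by omega, show p ≠ j by omega, show j ≠ q by omega, show j ≠ p by omega,
      show ¬ q < j by omega, show ¬ p < j by omega]
  · simp [show p ≠ j by omega, show j ≠ p by omega, show ¬ p < j by omega]
  · rcases lt_trichotomy j p with h' | rfl | h'
    · simp [show q ≠ j by omega, show p ≠ j by omega, show j ≠ q by omega, show j ≠ p by omega,
        h, h', show ¬ p < j by omega]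
    · simp [show q ≠ j by omega, show j ≠ q by omega, h, hι, hAdiag]
    · simp [show q ≠ j by omega, show p ≠ j by omega, show j ≠ q by omega, show j ≠ p by omega,
        h, h', show ¬ j < p by omega, hι]

lemma kplus_spec {ι : ℕ → I} (hι₂ : ∀ i : I, {k : ℕ | 1 ≤ k ∧ ι k = i}.Infinite) (k : ℕ) :
    k < kplus ι k ∧ ι (kplus ι k) = ι k := by
  obtain ⟨l, hl, hkl⟩ := (hι₂ (ι k)).exists_gt k
  exact Nat.sInf_mem (s := {l | k < l ∧ ι l = ι k}) ⟨l, hkl, hl.2⟩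

lemma kminus_spec {ι : ℕ → I} {k : ℕ} (hk : kminus ι k ≠ 0) :
    1 ≤ kminus ι k ∧ kminus ι k < k ∧ ι (kminus ι k) = ι k := by
  refine Nat.sSup_mem (s := {l | 1 ≤ l ∧ l < k ∧ ι l = ι k}) ?_ ⟨k, fun l hl => hl.2.1.le⟩
  by_contra h
  rw [Set.not_nonempty_iff_eq_empty] at h
  exact hk (by simp [kminus, h])

lemma kplus_kminus {ι : ℕ → I} {k : ℕ} (hk : kminus ι k ≠ 0) : kplus ι (kminus ι k) = k := by
  obtain ⟨h1, h2, h3⟩ := kminus_spec hk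
  have hmem : k ∈ {l | kminus ι k < l ∧ ι l = ι (kminus ι k)} := ⟨h2, h3.symm⟩
  refine le_antisymm (Nat.sInf_le hmem) ?_
  by_contra! hlt
  obtain ⟨h4, h5⟩ := Nat.sInf_mem ⟨k, hmem⟩
  have : kplus ι (kminus ι k) ≤ kminus ι k :=
    le_csSup (s := {l | 1 ≤ l ∧ l < k ∧ ι l = ι k}) ⟨k, fun l hl => hl.2.1.le⟩
      ⟨h1.trans h4.le, hlt, h5.trans h3⟩
  exact absurd h4 (not_lt.mpr this)

lemma sig_eq_zero (A : I → I → ℤ) (ι : ℕ → I) {x : ℕ →₀ ℤ} {L k : ℕ}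
    (hx : ∀ j, L < j → x j = 0) (hk : L < k) : sig A ι k x = 0 := by
  rw [sig, hx k hk, zero_add]
  refine Finset.sum_eq_zero fun j hj => ?_
  rw [hx j (hk.trans (Finset.mem_filter.1 hj).2), mul_zero]

lemma sig_eq_apply (A : I → I → ℤ) (ι : ℕ → I) {x : ℕ →₀ ℤ} {L : ℕ}
    (hx : ∀ j, L < j → x j = 0) : sig A ι L x = x L := by
  rw [sig, add_eq_left]
  refine Finset.sum_eq_zero fun j hj => ?_
  rw [hx j (Finset.mem_filter.1 hj).2, mul_zero]

lemma sig_bddAbove (A : I → I → ℤ) (ι : ℕ → I) (i : I) (x : ℕ →₀ ℤ) :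
    BddAbove ((fun k => sig A ι k x) '' {k | 1 ≤ k ∧ ι k = i}) := by
  obtain ⟨L, hL⟩ := x.support.bddAbove
  have hx : ∀ j, L < j → x j = 0 := fun j hj => by
    by_contra h
    exact absurd (hL (Finsupp.mem_support_iff.2 h)) (by omega)
  refine (((Set.finite_Iic L).image fun k => sig A ι k x).union
    (Set.finite_singleton 0)).bddAbove.mono ?_
  rintro _ ⟨k, -, rfl⟩
  rcases le_or_gt k L with h | h
  · exact Or.inl ⟨k, h, rfl⟩
  · exact Or.inr (sig_eq_zero A ι hx h)

lemma sig_le_sigMax (A : I → I → ℤ) {ι : ℕ → I} {i : I} (x : ℕ →₀ ℤ) {k : ℕ} (hk : 1 ≤ k)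
    (hi : ι k = i) : sig A ι k x ≤ sigMax A ι i x :=
  le_csSup (sig_bddAbove A ι i x) ⟨k, ⟨hk, hi⟩, rfl⟩

lemma Mset_nonempty (A : I → I → ℤ) {ι : ℕ → I}
    (hι₂ : ∀ i : I, {k : ℕ | 1 ≤ k ∧ ι k = i}.Infinite) (i : I) (x : ℕ →₀ ℤ) :
    (Mset A ι i x).Nonempty := by
  obtain ⟨k, hk, h⟩ := Int.csSup_mem ((hι₂ i).nonempty.image fun k => sig A ι k x)
    (sig_bddAbove A ι i x)
  exact ⟨k, hk.1, hk.2, h⟩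

/-- The polyhedral set `Σ_ι` cut out by the linear forms in `Ξ_ι`. -/
def XiCone (A : I → I → ℤ) (ι : ℕ → I) : Set (ℕ →₀ ℤ) :=
  {x | x 0 = 0 ∧ ∀ φ, XiInf A ι φ → 0 ≤ evalLin φ x}

lemma apply_nonneg_of_mem_XiCone {A : I → I → ℤ} {ι : ℕ → I} {x : ℕ →₀ ℤ} (hx : x ∈ XiCone A ι)
    {k : ℕ} (hk : 1 ≤ k) : 0 ≤ x k := by
  have h := hx.2 _ (.coord k hk)
  simpa [evalLin, Finsupp.support_single] using h

lemma ftilInf_mem_XiCone {A : I → I → ℤ} {ι : ℕ → I} (hAdiag : ∀ i, A i i = 2)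
    (hι₂ : ∀ i : I, {k : ℕ | 1 ≤ k ∧ ι k = i}.Infinite)
    (hpos : ∀ φ, XiInf A ι φ → ∀ k, 1 ≤ k → kminus ι k = 0 → 0 ≤ φ k)
    (i : I) {x : ℕ →₀ ℤ} (hx : x ∈ XiCone A ι) : ftilInf A ι i x ∈ XiCone A ι := by
  obtain ⟨hp1, hpi, hpM⟩ := Nat.sInf_mem (Mset_nonempty A hι₂ i x)
  set p := sInf (Mset A ι i x) with hp
  refine ⟨?_, fun φ hφ => ?_⟩
  · rw [ftilInf, ← hp, Finsupp.add_apply, hx.1, Finsupp.single_eq_of_ne (by omega), zero_add]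
  rw [ftilInf, ← hp, evalLin_add_single]
  rcases le_or_gt 0 (φ p) with h | h
  · linarith [hx.2 φ hφ]
  have hq : kminus ι p ≠ 0 := fun h0 => absurd (hpos φ hφ p hp1 h0) (by omega)
  obtain ⟨hq1, hqp, hqi⟩ := kminus_spec hq
  have hS := hx.2 _ (.s p hp1 φ hφ)
  rw [Sop, if_neg (by omega), evalLin_sub_smul,
    evalLin_betaInf hAdiag hq1 hqp hqi.symm (kplus_kminus hq)] at hS
  have hlt : sig A ι (kminus ι p) x < sig A ι p x := by
    rw [hpM]
    refine lt_of_le_of_ne (sig_le_sigMax A x hq1 (hqi.trans hpi)) fun he => ?_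
    exact absurd (Nat.sInf_le (show kminus ι p ∈ Mset A ι i x from ⟨hq1, hqi.trans hpi, he⟩))
      (by omega)
  nlinarith

/-- On `Σ_ι`, an element with `σ^{(i)} > 0` lies in the image of `f̃_i`. -/
lemma exists_ftilInf_eq {A : I → I → ℤ} {ι : ℕ → I} (hAdiag : ∀ i, A i i = 2)
    (hι₂ : ∀ i : I, {k : ℕ | 1 ≤ k ∧ ι k = i}.Infinite)
    {i : I} {x : ℕ →₀ ℤ} (hx : x ∈ XiCone A ι) {L : ℕ} (hL : ∀ k, L < k → x k = 0)
    (hσ : 0 < sigMax A ι i x) :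
    ∃ y ∈ XiCone A ι, (∀ k, L < k → y k = 0) ∧ sigMax A ι i y = sigMax A ι i x - 1 ∧
      ftilInf A ι i y = x := by
  have hbdd : ∀ k ∈ Mset A ι i x, k ≤ L := fun k hk => by
    by_contra! h
    have := sig_eq_zero A ι hL h
    have := hk.2.2
    omega
  obtain ⟨hp1, hpi, hpM⟩ := Nat.sSup_mem (Mset_nonempty A hι₂ i x) ⟨L, hbdd⟩
  have hpL : sSup (Mset A ι i x) ≤ L := hbdd _ ⟨hp1, hpi, hpM⟩
  have hmax : ∀ k ∈ Mset A ι i x, k ≤ sSup (Mset A ι i x) := fun k hk =>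
    le_csSup ⟨L, hbdd⟩ hk
  set p := sSup (Mset A ι i x)
  have hlt : ∀ k, p < k → ι k = i → sig A ι k x < sigMax A ι i x := fun k hk hki => by
    refine lt_of_le_of_ne (sig_le_sigMax A x (by omega) hki) fun he => ?_
    exact absurd (hmax k ⟨by omega, hki, he⟩) (by omega)
  set y := x + Finsupp.single p (-1) with hy
  have hyp : sig A ι p y = sigMax A ι i x - 1 := by
    rw [hy, sig_add_single, hpM, sigCoeff, if_pos rfl]
    ring
  have hylt : ∀ k, k < p → 1 ≤ k → ι k = i → sig A ι k y < sigMax A ι i x - 1 :=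
    fun k hk hk1 hki => by
      have := sig_le_sigMax A x hk1 hki
      rw [hy, sig_add_single, sigCoeff, if_neg (by omega), if_pos hk, hki, hpi, hAdiag]
      omega
  have hyle : ∀ k, 1 ≤ k → ι k = i → sig A ι k y ≤ sigMax A ι i x - 1 := fun k hk hki => by
    rcases lt_trichotomy k p with h | rfl | h
    · exact (hylt k h hk hki).le
    · exact hyp.le
    · have := hlt k h hki
      rw [hy, sig_add_single, sigCoeff, if_neg (by omega), if_neg (by omega)]
      omega
  have hyM : sigMax A ι i y = sigMax A ι i x - 1 := by
    refine le_antisymm (csSup_le ((hι₂ i).nonempty.image _) ?_) ?_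
    · rintro _ ⟨k, hk, rfl⟩
      exact hyle k hk.1 hk.2
    · exact hyp ▸ sig_le_sigMax A y hp1 hpi
  have hmin : sInf (Mset A ι i y) = p := by
    refine le_antisymm (Nat.sInf_le ⟨hp1, hpi, hyp.trans hyM.symm⟩) ?_
    obtain ⟨h1, h2, h3⟩ := Nat.sInf_mem (Mset_nonempty A hι₂ i y)
    by_contra! h
    have := hylt _ h h1 h2
    omega
  refine ⟨y, ⟨?_, fun φ hφ => ?_⟩, fun k hk => ?_, hyM, ?_⟩
  · rw [hy, Finsupp.add_apply, hx.1, Finsupp.single_eq_of_ne (by omega), zero_add]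
  · rw [hy, evalLin_add_single]
    rcases le_or_gt (φ p) 0 with h | h
    · linarith [hx.2 φ hφ]
    obtain ⟨h1, h2⟩ := kplus_spec hι₂ p
    have hS := hx.2 _ (.s p hp1 φ hφ)
    rw [Sop, if_pos h, evalLin_sub_smul, evalLin_betaInf hAdiag hp1 h1 h2 rfl] at hS
    have := hlt _ h1 (h2.trans hpi)
    nlinarith
  · rw [hy, Finsupp.add_apply, hL k hk, Finsupp.single_eq_of_ne (by omega), zero_add]
  · rw [ftilInf, hmin, hy, add_assoc, ← Finsupp.single_add]
    simp

lemma ftilInf_apply_eq_zero {A : I → I → ℤ} {ι : ℕ → I}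
    (hι₂ : ∀ i : I, {k : ℕ | 1 ≤ k ∧ ι k = i}.Infinite) {x : ℕ →₀ ℤ} {L : ℕ} (hL1 : 1 ≤ L)
    (hxL : 0 ≤ x L) (hL : ∀ k, L < k → x k = 0) {k : ℕ} (hk : L < k) :
    ftilInf A ι (ι L) x k = 0 := by
  have hle : sInf (Mset A ι (ι L) x) ≤ L := by
    by_contra! h
    obtain ⟨h1, h2, h3⟩ := Nat.sInf_mem (Mset_nonempty A hι₂ (ι L) x)
    have h0 := sig_eq_zero A ι hL h
    have h4 := sig_eq_apply A ι hL
    have h5 := sig_le_sigMax A (ι := ι) x hL1 rfl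
    exact absurd (Nat.sInf_le (show L ∈ Mset A ι (ι L) x from ⟨hL1, rfl, by omega⟩)) (by omega)
  rw [ftilInf, Finsupp.add_apply, hL k hk, Finsupp.single_eq_of_ne (by omega), zero_add]

/-- On `Σ_ι`, stripping `f̃_{i_L}` maximally empties the `L`-th coordinate. -/
lemma exists_iterate_ftilInf_eq {A : I → I → ℤ} {ι : ℕ → I} (hAdiag : ∀ i, A i i = 2)
    (hι₂ : ∀ i : I, {k : ℕ | 1 ≤ k ∧ ι k = i}.Infinite) {L : ℕ} {n : ℕ} {x : ℕ →₀ ℤ}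
    (hx : x ∈ XiCone A ι) (hL : ∀ k, L + 1 < k → x k = 0)
    (hn : sigMax A ι (ι (L + 1)) x ≤ n) :
    ∃ m, ∃ y ∈ XiCone A ι, (∀ k, L < k → y k = 0) ∧ (ftilInf A ι (ι (L + 1)))^[m] y = x := by
  induction n generalizing x with
  | zero =>
    refine ⟨0, x, hx, fun k hk => ?_, rfl⟩
    rcases eq_or_lt_of_le (Nat.succ_le_of_lt hk) with rfl | h
    · have h1 := sig_eq_apply A ι hL
      have h2 := sig_le_sigMax A (ι := ι) x (Nat.le_add_left 1 L) rfl
      have h3 := apply_nonneg_of_mem_XiCone hx (Nat.le_add_left 1 L)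
      simp only [Nat.succ_eq_add_one] at *
      omega
    · exact hL k h
  | succ n ih =>
    rcases le_or_gt (sigMax A ι (ι (L + 1)) x) 0 with h | h
    · exact ih hx hL (h.trans (by positivity))
    obtain ⟨y, hy, hyL, hyM, rfl⟩ := exists_ftilInf_eq hAdiag hι₂ hx hL h
    obtain ⟨m, z, hz, hzL, rfl⟩ := ih hy hyL (by push_cast at hn; omega)
    exact ⟨m + 1, z, hz, hzL, Function.iterate_succ_apply' _ _ _⟩

/-- Suppose `ι` satisfies the positivity assumption: whenever `k^{(-)} = 0`,
every `φ ∈ Ξ_ι` has `φ_k ≥ 0`. Let `w = s_{i_L}⋯s_{i_1}` be a reduced word whose letters are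
the first `L` terms of `ι`. Then
`D_L(∞) = { x ∈ ℤ^∞ : φ(x) ≥ 0 for all φ ∈ Ξ_ι, x_k = 0 for k > L }`. -/
theorem demazure_polytope_infinity_positive {I : Type*} [Fintype I] [DecidableEq I]
    (A : I → I → ℤ)
    (hAdiag : ∀ i, A i i = 2)
    (hAoff : ∀ i j, i ≠ j → A i j ≤ 0)
    (hAzero : ∀ i j, A i j = 0 ↔ A j i = 0)
    (hAsym : ∃ d : I → ℤ, (∀ i, 0 < d i) ∧ ∀ i j, d i * A i j = d j * A j i)
    (ι : ℕ → I)
    (hι₁ : ∀ k, 1 ≤ k → ι k ≠ ι (k + 1))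
    (hι₂ : ∀ i : I, {k : ℕ | 1 ≤ k ∧ ι k = i}.Infinite)
    (hpos : ∀ φ, XiInf A ι φ → ∀ k, 1 ≤ k → kminus ι k = 0 → 0 ≤ φ k)
    (L : ℕ)
    (hred : (coxOf A).toCoxeterSystem.IsReduced (demWord ι L)) :
    DemInf A ι L =
      {x : ℕ →₀ ℤ | x 0 = 0 ∧ (∀ φ, XiInf A ι φ → 0 ≤ evalLin φ x) ∧
        ∀ k, L < k → x k = 0} := by
  suffices h : DemInf A ι L = {x | x ∈ XiCone A ι ∧ ∀ k, L < k → x k = 0} by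
    rw [h]
    ext x
    exact and_assoc
  clear hred
  induction L with
  | zero =>
    ext x
    constructor
    · rintro rfl
      exact ⟨⟨rfl, fun φ _ => by simp [evalLin]⟩, fun _ _ => rfl⟩
    · rintro ⟨hx, hL⟩
      ext k
      rcases Nat.eq_zero_or_pos k with rfl | hk
      · exact hx.1
      · exact hL k hk
  | succ L ih =>
    ext x
    constructor
    · rintro ⟨m, y, hy, rfl⟩
      rw [ih] at hy
      induction m with
      | zero => exact ⟨hy.1, fun k hk => hy.2 k (by omega)⟩
      | succ m ihm =>
        rw [Function.iterate_succ_apply']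
        exact ⟨ftilInf_mem_XiCone hAdiag hι₂ hpos _ ihm.1, fun k hk =>
          ftilInf_apply_eq_zero hι₂ (by omega) (apply_nonneg_of_mem_XiCone ihm.1 (by omega)) ihm.2 hk⟩
    · rintro ⟨hx, hL⟩
      obtain ⟨m, y, hy, hyL, rfl⟩ :=
        exists_iterate_ftilInf_eq hAdiag hι₂ hx hL (Int.self_le_toNat _)
      exact ⟨m, y, ih ▸ ⟨hy, hyL⟩, rfl⟩

end PaperNakashima
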